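/- Let X be a spectral space. The following are equivalent: (i) qccl(X) is a Stone algebra; (ii) for every C ∈ qccl(X), the closure ↓C of C in the inverse topology is open in the inverse topology; (iii) X is a normal topological space and qccl(X) is pseudocomplemented; (iv) X is a normal topological space and X^max is patch closed. -/

import Mathlib

open Set Topology

namespace PCF

variable {X : Type*}

/-- The compact open subsets of a topological space. -/
def qcop (t : TopologicalSpace X) : Set (Set X) :=
  {U | @IsOpen X t U ∧ @IsCompact X t U}

/-- The complements of the compact open subsets. -/
def qccl (t : TopologicalSpace X) : Set (Set X) :=
  {C | ∃ U ∈ qcop t, C = Uᶜ}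

/-- The Boolean algebra of subsets generated by the compact open sets:
the constructible sets. -/
def Constructible (t : TopologicalSpace X) : Set (Set X) :=
  ⋂₀ {B : Set (Set X) | qcop t ⊆ B ∧ (∀ s ∈ B, sᶜ ∈ B) ∧
        (∀ s ∈ B, ∀ u ∈ B, s ∪ u ∈ B) ∧ (∅ : Set X) ∈ B}

/-- The patch topology: generated by the compact open sets together with their
complements (equivalently, by the constructible sets). -/
def patchTop (t : TopologicalSpace X) : TopologicalSpace X :=
  TopologicalSpace.generateFrom (qcop t ∪ qccl t)

/-- The inverse topology, with the complements of compact opens as a basis of opens. -/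
def invTop (t : TopologicalSpace X) : TopologicalSpace X :=
  TopologicalSpace.generateFrom (qccl t)

/-- The specialization order: `x ≤ y` iff `y` is in the closure of `{x}`. -/
def specLE (t : TopologicalSpace X) (x y : X) : Prop := y ∈ @closure X t {x}

/-- Minimal points for the specialization order. -/
def minPts (t : TopologicalSpace X) : Set X := {x | ∀ y, specLE t y x → y = x}

/-- Maximal points for the specialization order. -/
def maxPts (t : TopologicalSpace X) : Set X := {x | ∀ y, specLE t x y → y = x}

/-- Minimal points of a subset `S`, for the induced specialization order. -/
def minPtsIn (t : TopologicalSpace X) (S : Set X) : Set X :=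
  {x | x ∈ S ∧ ∀ y ∈ S, specLE t y x → y = x}

/-- Maximal points of a subset `S`, for the induced specialization order. -/
def maxPtsIn (t : TopologicalSpace X) (S : Set X) : Set X :=
  {x | x ∈ S ∧ ∀ y ∈ S, specLE t x y → y = x}

/-- The down-set (set of generalizations) generated by `S`. -/
def downset (t : TopologicalSpace X) (S : Set X) : Set X :=
  {x | ∃ s ∈ S, specLE t x s}

/-- The up-set (set of specializations) generated by `S`. -/
def upset (t : TopologicalSpace X) (S : Set X) : Set X :=
  {x | ∃ s ∈ S, specLE t s x}

/-- A topology is spectral if the space is compact, sober (quasi-sober and T0),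
the compact opens form a basis, and the compact opens are closed under
finite intersections. -/
def IsSpectral (t : TopologicalSpace X) : Prop :=
  @CompactSpace X t ∧ @QuasiSober X t ∧ @T0Space X t ∧
  @TopologicalSpace.IsTopologicalBasis X t (qcop t) ∧
  ∀ U ∈ qcop t, ∀ V ∈ qcop t, U ∩ V ∈ qcop t

/-- A Boolean space: compact, Hausdorff and zero-dimensional. -/
def IsBooleanSpace (t : TopologicalSpace X) : Prop :=
  @CompactSpace X t ∧ @T2Space X t ∧
  @TopologicalSpace.IsTopologicalBasis X t {U | @IsClopen X t U}

/-- `V` is the pseudocomplement of `U` in the lattice of sets `L` (ordered by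
inclusion, with meet given by intersection and bottom element `∅`): `V` is the
largest element of `L` disjoint from `U`. -/
def IsPseudoCompl (L : Set (Set X)) (U V : Set X) : Prop :=
  V ∈ L ∧ U ∩ V = ∅ ∧ ∀ W ∈ L, U ∩ W = ∅ → W ⊆ V

/-- The lattice of sets `L` is pseudocomplemented: every element has a
pseudocomplement. -/
def Pseudocomplemented (L : Set (Set X)) : Prop :=
  ∀ U ∈ L, ∃ V, IsPseudoCompl L U V

/-- The lattice of sets `L` is a Stone algebra: it is pseudocomplemented and
`U* ∪ U** = ⊤` for every `U`. -/
def StoneAlgebra (L : Set (Set X)) : Prop :=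
  Pseudocomplemented L ∧
  ∀ U ∈ L, ∀ V W : Set X, IsPseudoCompl L U V → IsPseudoCompl L V W → V ∪ W = univ

/-- The lattice of sets `L` is a Heyting algebra: for all `U, V ∈ L` there is a
largest `W ∈ L` with `U ∩ W ⊆ V`. -/
def HeytingAlg (L : Set (Set X)) : Prop :=
  ∀ U ∈ L, ∀ V ∈ L, ∃ W ∈ L, U ∩ W ⊆ V ∧ ∀ W' ∈ L, U ∩ W' ⊆ V → W' ⊆ W

/-- A PC-space: the lattice of compact open sets is pseudocomplemented. -/
def IsPCSpace (t : TopologicalSpace X) : Prop := Pseudocomplemented (qcop t)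

/-- An Esakia space: the closure of every constructible set is constructible. -/
def IsEsakia (t : TopologicalSpace X) : Prop :=
  ∀ S ∈ Constructible t, @closure X t S ∈ Constructible t

/-- A spectral root system: the closure of every point is a specialization chain. -/
def IsRootSystem (t : TopologicalSpace X) : Prop :=
  ∀ x : X, IsChain (specLE t) (@closure X t {x})

/-- A spectral forest: the inverse space is a spectral root system. -/
def IsForest (t : TopologicalSpace X) : Prop := IsRootSystem (invTop t)

/-- A stranded space: the specialization poset is a disjoint union of chains, i.e.
the set of points comparable with any fixed point is a chain. -/
def Stranded (t : TopologicalSpace X) : Prop :=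
  ∀ x : X, IsChain (specLE t) {y | specLE t x y ∨ specLE t y x}

end PCF

open PCF

section Rings

variable (T : Type*) [TopologicalSpace T]

/-- The zero set of a continuous real-valued function. -/
def zeroSet (f : ContinuousMap T ℝ) : Set T := {t | f t = 0}

/-- The lattice of cozero sets of a topological space. -/
def Coz : Set (Set T) := {U | ∃ f : ContinuousMap T ℝ, U = {t | f t ≠ 0}}

/-- A z-ideal of the ring `C(T)` of continuous real-valued functions. -/
def IsZIdeal (I : Ideal (ContinuousMap T ℝ)) : Prop :=
  ∀ f ∈ I, ∀ g : ContinuousMap T ℝ, zeroSet T f ⊆ zeroSet T g → g ∈ I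

/-- The prime z-ideals, as a subset of the prime spectrum of `C(T)`. -/
def zSpec : Set (PrimeSpectrum (ContinuousMap T ℝ)) :=
  {p | IsZIdeal T p.asIdeal}

/-- A space is basically disconnected if the closure of every cozero set is open. -/
def BasicallyDisconnected : Prop :=
  ∀ f : ContinuousMap T ℝ, IsOpen (closure {t | f t ≠ 0})

/-- The Zariski topology on the prime spectrum of `C(T)`. -/
def specTop : TopologicalSpace (PrimeSpectrum (ContinuousMap T ℝ)) := inferInstance

/-- The subspace topology on the set of prime z-ideals. -/
def zTop : TopologicalSpace ↥(zSpec T) := inferInstance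

end Rings

/-- The subspace topology on a subset. -/
def subTop {Y : Type*} [TopologicalSpace Y] (X : Set Y) : TopologicalSpace ↥X :=
  inferInstance

namespace PCF

variable {X : Type*}

theorem IsPseudoCompl.eq_compl_of_compl_mem {L : Set (Set X)} {V W : Set X}
    (h : IsPseudoCompl L V W) (hV : Vᶜ ∈ L) : W = Vᶜ :=
  (disjoint_iff_inter_eq_empty.2 h.2.1).symm.subset_compl_right.antisymm
    (h.2.2 _ hV (inter_compl_self V))

section SpectralSpace

variable [t : TopologicalSpace X]

theorem mem_qccl_iff {C : Set X} : C ∈ qccl t ↔ IsClosed C ∧ IsCompact Cᶜ := by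
  constructor
  · rintro ⟨U, ⟨hU, hU'⟩, rfl⟩
    exact ⟨hU.isClosed_compl, by rwa [compl_compl]⟩
  · rintro ⟨hC, hC'⟩
    exact ⟨Cᶜ, ⟨hC.isOpen_compl, hC'⟩, (compl_compl C).symm⟩

theorem compl_mem_qccl {W : Set X} (hW : IsOpen W) (hW' : IsCompact W) : Wᶜ ∈ qccl t :=
  ⟨W, ⟨hW, hW'⟩, rfl⟩

theorem qccl_union [QuasiSeparatedSpace X] {C D : Set X} (hC : C ∈ qccl t) (hD : D ∈ qccl t) :
    C ∪ D ∈ qccl t := by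
  rw [mem_qccl_iff] at *
  refine ⟨hC.1.union hD.1, ?_⟩
  rw [compl_union]
  exact hC.2.inter_of_isOpen hD.2 hC.1.isOpen_compl hD.1.isOpen_compl

theorem qccl_inter {C D : Set X} (hC : C ∈ qccl t) (hD : D ∈ qccl t) : C ∩ D ∈ qccl t := by
  rw [mem_qccl_iff] at *
  refine ⟨hC.1.inter hD.1, ?_⟩
  rw [compl_inter]
  exact hC.2.union hD.2

theorem univ_mem_qccl : (univ : Set X) ∈ qccl t := by simp [mem_qccl_iff]

theorem isTopologicalBasis_qccl :
    @TopologicalSpace.IsTopologicalBasis X (invTop t) (qccl t) :=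
  @TopologicalSpace.IsTopologicalBasis.mk X (invTop t) (qccl t)
    (fun C hC D hD _ hx ↦ ⟨C ∩ D, qccl_inter hC hD, hx, subset_rfl⟩)
    (sUnion_eq_univ_iff.2 fun _ ↦ ⟨univ, univ_mem_qccl, trivial⟩) rfl

theorem isOpen_invTop_of_mem_qccl {C : Set X} (hC : C ∈ qccl t) : IsOpen[invTop t] C :=
  TopologicalSpace.isOpen_generateFrom_of_mem hC

theorem mem_closure_invTop_iff {C : Set X} {x : X} :
    x ∈ @closure X (invTop t) C ↔ ∀ D ∈ qccl t, x ∈ D → (D ∩ C).Nonempty :=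
  @TopologicalSpace.IsTopologicalBasis.mem_closure_iff X (invTop t) _ isTopologicalBasis_qccl _ _

theorem patchTop_eq_constructibleTopology : patchTop t = constructibleTopology X := by
  have h : qccl t = {s | IsClosed s ∧ IsCompact sᶜ} := Set.ext fun _ ↦ mem_qccl_iff
  rw [patchTop, h]
  rfl

theorem compactSpace_patchTop [SpectralSpace X] : @CompactSpace X (patchTop t) := by
  rw [patchTop_eq_constructibleTopology]
  exact @Function.Surjective.compactSpace _ _ _ (constructibleTopology X) _
    (WithTopology.continuous_ofTopology _) inferInstance (WithTopology.ofTopology_surjective _)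

theorem patchTop_le_invTop : patchTop t ≤ invTop t :=
  TopologicalSpace.generateFrom_anti subset_union_right

theorem compactSpace_invTop [SpectralSpace X] : @CompactSpace X (invTop t) :=
  @CompactSpace.mk X (invTop t) <| by
    have h := @isCompact_univ X (patchTop t) compactSpace_patchTop
    have := @IsCompact.image X X (patchTop t) (invTop t) _ id h
      (continuous_id_iff_le.2 patchTop_le_invTop)
    simpa using this

theorem patchTop_le [PrespectralSpace X] : patchTop t ≤ t := by
  conv_rhs => rw [(PrespectralSpace.isTopologicalBasis (X := X)).eq_generateFrom]
  exact TopologicalSpace.generateFrom_anti subset_union_left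

/-- A clopen set of the inverse topology is the complement of a compact open set. -/
theorem mem_qccl_of_isClopen_invTop [SpectralSpace X] {S : Set X}
    (hS : IsOpen[invTop t] S) (hS' : IsClosed[invTop t] S) : S ∈ qccl t := by
  have hc : @IsCompact X (invTop t) S := @IsClosed.isCompact X (invTop t) _ compactSpace_invTop hS'
  suffices h : ∃ D ∈ qccl t, S ⊆ D ∧ D ⊆ S by
    obtain ⟨D, hD, h₁, h₂⟩ := h
    rwa [h₁.antisymm h₂]
  refine @IsCompact.induction_on X (invTop t) S hc (fun s ↦ ∃ D ∈ qccl t, s ⊆ D ∧ D ⊆ S)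
    ⟨∅, by simpa [mem_qccl_iff] using isCompact_univ, subset_rfl, empty_subset _⟩ ?_ ?_ ?_
  · rintro s s' hs ⟨D, hD, h, h'⟩
    exact ⟨D, hD, hs.trans h, h'⟩
  · rintro s s' ⟨D, hD, h, h'⟩ ⟨E, hE, k, k'⟩
    exact ⟨D ∪ E, qccl_union hD hE, union_subset_union h k, union_subset h' k'⟩
  · intro x hx
    obtain ⟨D, hD, hxD, hDS⟩ := 
      @TopologicalSpace.IsTopologicalBasis.exists_subset_of_mem_open X (invTop t) _
        isTopologicalBasis_qccl _ _ hx hS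
    refine ⟨D, @mem_nhdsWithin_of_mem_nhds X (invTop t) _ _ _ ?_, D, hD, subset_rfl, hDS⟩
    exact @IsOpen.mem_nhds X (invTop t) x _ (isOpen_invTop_of_mem_qccl hD) hxD

/-- A closed set `A` contained in an open set `O` is disjoint from a member of `qccl` containing
the complement of `O`. -/
theorem exists_qccl_between [CompactSpace X] [PrespectralSpace X] {A O : Set X}
    (hA : IsClosed A) (hO : IsOpen O) (h : A ⊆ O) : ∃ F ∈ qccl t, A ∩ F = ∅ ∧ Oᶜ ⊆ F := by
  obtain ⟨W, hWc, hWo, hAW, hWO⟩ :=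
    PrespectralSpace.exists_isCompact_and_isOpen_between hA.isCompact hO h
  refine ⟨Wᶜ, compl_mem_qccl hWo hWc, ?_, compl_subset_compl.2 hWO⟩
  rw [← sdiff_eq, sdiff_eq_empty]
  exact hAW

theorem IsPseudoCompl.eq_compl_closure {C V : Set X} (h : IsPseudoCompl (qccl t) C V) :
    V = (@closure X (invTop t) C)ᶜ := by
  ext x
  rw [mem_compl_iff, mem_closure_invTop_iff]
  push Not
  constructor
  · intro hx
    exact ⟨V, h.1, hx, by rw [inter_comm]; exact h.2.1⟩
  · rintro ⟨D, hD, hxD, hDC⟩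
    exact h.2.2 D hD (by rwa [inter_comm]) hxD

theorem isPseudoCompl_compl_closure {C : Set X} (h : (@closure X (invTop t) C)ᶜ ∈ qccl t) :
    IsPseudoCompl (qccl t) C (@closure X (invTop t) C)ᶜ := by
  refine ⟨h, ?_, fun D hD hCD x hx ↦ ?_⟩
  · rw [← sdiff_eq, sdiff_eq_empty]
    exact @subset_closure X (invTop t) C
  · rw [mem_compl_iff, mem_closure_invTop_iff]
    push Not
    exact ⟨D, hD, hx, by rwa [inter_comm]⟩

theorem StoneAlgebra.isOpen_closure (h : StoneAlgebra (qccl t)) {C : Set X} (hC : C ∈ qccl t) :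
    IsOpen[invTop t] (@closure X (invTop t) C) := by
  obtain ⟨V, hV⟩ := h.1 C hC
  obtain ⟨W, hW⟩ := h.1 V hV.1
  have hWV : W = Vᶜ := by
    refine (disjoint_iff_inter_eq_empty.2 hW.2.1).symm.subset_compl_right.antisymm fun x hx ↦ ?_
    exact (h.2 C hC V W hV hW ▸ mem_univ x : x ∈ V ∪ W).resolve_left hx
  rw [hV.eq_compl_closure, compl_compl] at hWV
  exact hWV ▸ isOpen_invTop_of_mem_qccl hW.1

theorem stoneAlgebra_of_isOpen_closure [SpectralSpace X]
    (h : ∀ C ∈ qccl t, IsOpen[invTop t] (@closure X (invTop t) C)) : StoneAlgebra (qccl t) := by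
  have hcl (C) (hC : C ∈ qccl t) : @closure X (invTop t) C ∈ qccl t :=
    mem_qccl_of_isClopen_invTop (h C hC) (@isClosed_closure X (invTop t) C)
  have hcl' (C) (hC : C ∈ qccl t) : (@closure X (invTop t) C)ᶜ ∈ qccl t :=
    mem_qccl_of_isClopen_invTop (@IsClosed.isOpen_compl X (invTop t) _
      (@isClosed_closure X (invTop t) C)) (@IsOpen.isClosed_compl X (invTop t) _ (h C hC))
  refine ⟨fun C hC ↦ ⟨_, isPseudoCompl_compl_closure (hcl' C hC)⟩, fun C hC V W hV hW ↦ ?_⟩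
  have hVc : Vᶜ ∈ qccl t := by
    rw [hV.eq_compl_closure, compl_compl]
    exact hcl C hC
  rw [hW.eq_compl_of_compl_mem hVc, union_compl_self]

theorem StoneAlgebra.normalSpace [CompactSpace X] [PrespectralSpace X]
    (h : StoneAlgebra (qccl t)) : NormalSpace X := by
  refine ⟨fun A B hA hB hAB ↦ ?_⟩
  obtain ⟨D, hD, hAD, hBD⟩ :=
    exists_qccl_between hA hB.isOpen_compl hAB.subset_compl_right
  rw [compl_compl] at hBD
  have hDc := (mem_qccl_iff.1 hD).1
  obtain ⟨C, hC, hDC, hAC⟩ := exists_qccl_between hDc hA.isOpen_compl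
    (disjoint_iff_inter_eq_empty.2 hAD).symm.subset_compl_right
  rw [compl_compl] at hAC
  obtain ⟨V, hV⟩ := h.1 C hC
  obtain ⟨W, hW⟩ := h.1 V hV.1
  have hVW := h.2 C hC V W hV hW
  have hVc := (mem_qccl_iff.1 hV.1).1
  have hWV : Wᶜ = V := by
    have := hW.2.1
    ext x
    have h₁ : x ∈ V ∪ W := hVW ▸ mem_univ x
    have h₂ : x ∉ V ∩ W := this ▸ notMem_empty x
    simp only [mem_union, mem_inter_iff, mem_compl_iff] at *
    tauto
  refine ⟨Vᶜ, V, hVc.isOpen_compl, ?_, ?_, ?_, disjoint_compl_left⟩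
  · exact hWV ▸ (mem_qccl_iff.1 hW.1).1.isOpen_compl
  · exact hAC.trans (disjoint_iff_inter_eq_empty.2 hV.2.1).subset_compl_right
  · exact hBD.trans (hV.2.2 D hD (by rwa [inter_comm]))

theorem Pseudocomplemented.stoneAlgebra [CompactSpace X] [PrespectralSpace X] [NormalSpace X]
    (h : Pseudocomplemented (qccl t)) : StoneAlgebra (qccl t) := by
  refine ⟨h, fun C hC V W hV hW ↦ ?_⟩
  have hCc := (mem_qccl_iff.1 hC).1
  have hVc := (mem_qccl_iff.1 hV.1).1
  obtain ⟨O, P, hO, hP, hCO, hVP, hOP⟩ :=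
    normal_separation hCc hVc (disjoint_iff_inter_eq_empty.2 hV.2.1)
  obtain ⟨F, hF, hCF, hOF⟩ := exists_qccl_between hCc hO hCO
  obtain ⟨G, hG, hVG, hPG⟩ := exists_qccl_between hVc hP hVP
  refine eq_univ_of_forall fun x ↦ ?_
  by_cases hx : x ∈ O
  · exact .inr (hW.2.2 G hG hVG (hPG (hOP.notMem_of_mem_left hx)))
  · exact .inl (hV.2.2 F hF hCF (hOF hx))

theorem mem_maxPts_iff [T0Space X] {x : X} : x ∈ maxPts t ↔ IsClosed {x} := by
  rw [← closure_subset_iff_isClosed]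
  rfl

theorem exists_maxPts_mem [T0Space X] [CompactSpace X] {A : Set X} (hA : IsClosed A) {x : X}
    (hx : x ∈ A) : ∃ m ∈ maxPts t, m ∈ closure {x} ∧ m ∈ A := by
  obtain ⟨m, hm, hm'⟩ := isClosed_closure.exists_closed_singleton
    (singleton_nonempty x).closure
  exact ⟨m, mem_maxPts_iff.2 hm', hm, closure_minimal (singleton_subset_iff.2 hx) hA hm⟩

theorem Pseudocomplemented.isClosed_maxPts [SpectralSpace X] (h : Pseudocomplemented (qccl t)) :
    IsClosed (maxPts t) := by
  choose! V hV using h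
  have key : maxPts t = ⋂ C ∈ qccl t, C ∪ V C := by
    ext x
    rw [mem_iInter₂]
    constructor
    · intro hx C hC
      refine or_iff_not_imp_left.2 fun hxC ↦ ?_
      have hCc := (mem_qccl_iff.1 hC).1
      obtain ⟨D, hD, hCD, hxD⟩ := exists_qccl_between hCc (mem_maxPts_iff.1 hx).isOpen_compl
        (subset_compl_singleton_iff.2 hxC)
      exact (hV C hC).2.2 D hD hCD (hxD (by simp))
    · intro hx y hy
      by_contra hne
      have hxy : x ∉ closure {y} := fun hxy ↦
        hne (specializes_iff_mem_closure.2 hxy |>.antisymm (specializes_iff_mem_closure.2 hy)).eq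
      obtain ⟨U, ⟨hUo, hUc⟩, hxU, hUy⟩ :=
        PrespectralSpace.isTopologicalBasis.exists_subset_of_mem_open
          (mem_compl hxy) isClosed_closure.isOpen_compl
      have hC := compl_mem_qccl hUo hUc
      have hyU : y ∈ Uᶜ := fun hyU ↦ hUy hyU (subset_closure rfl)
      have hxV := (hx _ hC).resolve_left (not_not.2 hxU)
      have hVc := (mem_qccl_iff.1 (hV _ hC).1).1
      have hyV := closure_minimal (singleton_subset_iff.2 hxV) hVc hy
      exact notMem_empty y ((hV _ hC).2.1 ▸ ⟨hyU, hyV⟩)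
  rw [key]
  exact isClosed_biInter fun C hC ↦
    (mem_qccl_iff.1 hC).1.union (mem_qccl_iff.1 (hV C hC).1).1

/-- A patch closed set that is stable under specialization is closed. -/
theorem isClosed_of_isClosed_patchTop [SpectralSpace X] {K : Set X}
    (hK : IsClosed[patchTop t] K) (hs : StableUnderSpecialization K) : IsClosed K := by
  have hKc := @IsClosed.isCompact X (patchTop t) _ compactSpace_patchTop hK
  rw [← isOpen_compl_iff, isOpen_iff_forall_mem_open]
  intro y hy
  suffices h : ∃ U, IsOpen U ∧ y ∈ U ∧ Disjoint K U by
    obtain ⟨U, hU, hyU, hd⟩ := h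
    exact ⟨U, hd.symm.subset_compl_right, hU, hyU⟩
  refine @IsCompact.induction_on X (patchTop t) K hKc
    (fun s ↦ ∃ U, IsOpen U ∧ y ∈ U ∧ Disjoint s U) ⟨univ, isOpen_univ, trivial, by simp⟩ ?_ ?_ ?_
  · rintro s s' hs ⟨U, hU, hyU, hd⟩
    exact ⟨U, hU, hyU, hd.mono_left hs⟩
  · rintro s s' ⟨U, hU, hyU, hd⟩ ⟨U', hU', hyU', hd'⟩
    exact ⟨U ∩ U', hU.inter hU', ⟨hyU, hyU'⟩, disjoint_union_left.2
      ⟨hd.mono_right inter_subset_left, hd'.mono_right inter_subset_right⟩⟩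
  · intro k hk
    have hyk : y ∉ closure {k} := fun h ↦ hy (hs (specializes_iff_mem_closure.2 h) hk)
    obtain ⟨U, hU, hyU, hUk⟩ := PrespectralSpace.isTopologicalBasis.exists_subset_of_mem_open
      (mem_compl hyk) isClosed_closure.isOpen_compl
    refine ⟨Uᶜ, @mem_nhdsWithin_of_mem_nhds X (patchTop t) _ _ _ ?_, U, hU.1, hyU,
      disjoint_compl_left⟩
    refine @IsOpen.mem_nhds X (patchTop t) k _ ?_ fun hkU ↦ hUk hkU (subset_closure rfl)
    exact TopologicalSpace.isOpen_generateFrom_of_mem (.inr (compl_mem_qccl hU.1 hU.2))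

theorem stableUnderSpecialization_of_subset_maxPts {K : Set X} (hK : K ⊆ maxPts t) :
    StableUnderSpecialization K := fun _ y hxy hx ↦
  (hK hx y (specializes_iff_mem_closure.1 hxy)).symm ▸ hx

theorem pseudocomplemented_of_isClosed_maxPts [SpectralSpace X] [NormalSpace X]
    (h : IsClosed[patchTop t] (maxPts t)) : Pseudocomplemented (qccl t) := by
  intro C hC
  have hCc := (mem_qccl_iff.1 hC).1
  have hA : IsClosed (maxPts t ∩ C) :=
    (isClosed_of_isClosed_patchTop h (stableUnderSpecialization_of_subset_maxPts subset_rfl)).inter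
      hCc
  have hB : IsClosed (maxPts t ∩ Cᶜ) := by
    refine isClosed_of_isClosed_patchTop ?_
      (stableUnderSpecialization_of_subset_maxPts inter_subset_left)
    refine @IsClosed.inter X _ _ (patchTop t) h (@IsOpen.isClosed_compl X (patchTop t) _ ?_)
    exact TopologicalSpace.isOpen_generateFrom_of_mem (.inr hC)
  obtain ⟨O, P, hO, hP, hAO, hBP, hOP⟩ := normal_separation hA hB
    (disjoint_compl_right.mono inter_subset_right inter_subset_right)
  have hPO : Pᶜ = O := by
    refine Subset.antisymm (fun x hxP ↦ ?_) hOP.subset_compl_right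
    by_contra hxO
    obtain ⟨m, hm, -, hmP, hmO⟩ :=
      exists_maxPts_mem (hP.isClosed_compl.inter hO.isClosed_compl) ⟨hxP, hxO⟩
    by_cases hmC : m ∈ C
    · exact hmO (hAO ⟨hm, hmC⟩)
    · exact hmP (hBP ⟨hm, hmC⟩)
  have hOc : IsClosed O := hPO ▸ hP.isClosed_compl
  refine ⟨Oᶜ, compl_mem_qccl hO hOc.isCompact, ?_, fun D hD hCD x hxD hxO ↦ ?_⟩
  · refine eq_empty_of_forall_notMem fun x hx ↦ ?_
    obtain ⟨m, hm, -, hmC, hmO⟩ := exists_maxPts_mem (hCc.inter hO.isClosed_compl) hx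
    exact hmO (hAO ⟨hm, hmC⟩)
  · obtain ⟨m, hm, -, hmD, hmO⟩ :=
      exists_maxPts_mem ((mem_qccl_iff.1 hD).1.inter hOc) ⟨hxD, hxO⟩
    have hmC : m ∉ C := fun hmC ↦ notMem_empty m (hCD ▸ ⟨hmC, hmD⟩)
    exact hOP.notMem_of_mem_left hmO (hBP ⟨hm, hmC⟩)

theorem IsSpectral.spectralSpace (hX : IsSpectral t) : SpectralSpace X := by
  obtain ⟨_, _, _, hb, hi⟩ := hX
  exact
    { isTopologicalBasis := hb
      inter_isCompact := fun U V hU hU' hV hV' ↦ (hi U ⟨hU, hU'⟩ V ⟨hV, hV'⟩).2 }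

end SpectralSpace

end PCF

/-- For a spectral space `X`, TFAE: (i) `qccl X` is a Stone algebra;
(ii) for every `C ∈ qccl X`, the closure of `C` in the inverse topology is open in the
inverse topology; (iii) `X` is normal and `qccl X` is pseudocomplemented; (iv) `X` is
normal and `X^max` is patch closed. -/
theorem statement_3 {X : Type*} [t : TopologicalSpace X] (hX : IsSpectral t) :
    List.TFAE
      [ StoneAlgebra (qccl t),
        ∀ C ∈ qccl t, IsOpen[invTop t] (@closure X (invTop t) C),
        NormalSpace X ∧ Pseudocomplemented (qccl t),
        NormalSpace X ∧ IsClosed[patchTop t] (maxPts t) ] := by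
  have := hX.spectralSpace
  tfae_have 1 → 2 := fun h _ hC ↦ h.isOpen_closure hC
  tfae_have 2 → 1 := stoneAlgebra_of_isOpen_closure
  tfae_have 1 → 3 := fun h ↦ ⟨h.normalSpace, h.1⟩
  tfae_have 3 → 1 := fun ⟨_, h⟩ ↦ h.stoneAlgebra
  tfae_have 3 → 4 := fun ⟨hn, h⟩ ↦ ⟨hn, h.isClosed_maxPts.mono patchTop_le⟩
  tfae_have 4 → 3 := fun ⟨hn, h⟩ ↦ ⟨hn, pseudocomplemented_of_isClosed_maxPts h⟩
  tfae_finish
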